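/- arXiv:2309.02748 — 3 statements merged into one kernel-verified Lean document; each statement's English description precedes it below -/
import Mathlib

section
/- Every language over a finite alphabet Σ accepted by a Boolean finite automaton with n states is accepted by a nondeterministic finite automaton with a unique initial state having at most 2^n + 1 states. Moreover, for every n ≥ 2 there exists a language over a two-letter alphabet accepted by an n-state alternating finite automaton such that every nondeterministic finite automaton with a unique initial state accepting it has at least 2^n + 1 states. -/
/-- A Boolean finite automaton (BFA): `δ` maps each state and symbol to a
Boolean function in the state variables, `g` is the initial Boolean function,
and `accept` is the finality (characteristic) vector of the final state set. -/
structure BFA (α : Type) (σ : Type) where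
  δ : σ → α → (σ → Bool) → Bool
  g : (σ → Bool) → Bool
  accept : σ → Bool

namespace BFA

variable {α σ : Type}

/-- One-symbol action on Boolean functions: `(h·a)(v) = h (fun q => δ q a v)`. -/
def stepFn (A : BFA α σ) (h : (σ → Bool) → Bool) (a : α) : (σ → Bool) → Bool :=
  fun v => h fun q => A.δ q a v

/-- Action of a string on the initial function: `g·ε = g`, `g·(wa) = (g·w)·a`. -/
def eval (A : BFA α σ) (w : List α) : (σ → Bool) → Bool :=
  w.foldl A.stepFn A.g

/-- The language of a BFA: strings whose resulting Boolean function
evaluates to `true` on the finality vector. -/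
def language (A : BFA α σ) : Language α :=
  { w | A.eval w A.accept = true }

/-- A BFA is alternating (an AFA) if its initial function is a projection. -/
def IsAFA (A : BFA α σ) : Prop :=
  ∃ q₀ : σ, A.g = fun v => v q₀

end BFA

/-- `L` is accepted by some `n`-state BFA. -/
def AcceptsBFA {α : Type} (L : Language α) (n : ℕ) : Prop :=
  ∃ (σ : Type) (_ : Fintype σ), Fintype.card σ = n ∧ ∃ A : BFA α σ, A.language = L

/-- `L` is accepted by some `n`-state AFA. -/
def AcceptsAFA {α : Type} (L : Language α) (n : ℕ) : Prop :=
  ∃ (σ : Type) (_ : Fintype σ), Fintype.card σ = n ∧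
    ∃ A : BFA α σ, A.IsAFA ∧ A.language = L

/-- `L` is accepted by some `n`-state DFA. -/
def AcceptsDFA {α : Type} (L : Language α) (n : ℕ) : Prop :=
  ∃ (σ : Type) (_ : Fintype σ), Fintype.card σ = n ∧ ∃ D : DFA α σ, D.accepts = L

/-- `L` is accepted by some `n`-state NFA with a unique initial state. -/
def AcceptsNFA1 {α : Type} (L : Language α) (n : ℕ) : Prop :=
  ∃ (σ : Type) (_ : Fintype σ), Fintype.card σ = n ∧
    ∃ (M : NFA α σ) (q₀ : σ), M.start = {q₀} ∧ M.accepts = L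

/-- The reversal of a language. -/
def Language.rev {α : Type} (L : Language α) : Language α :=
  { w | w.reverse ∈ L }

namespace BFA

variable {α σ : Type}

/-- The action of a letter on state vectors; strings act from right to left. -/
def act (A : BFA α σ) (a : α) (v : σ → Bool) : σ → Bool :=
  fun q => A.δ q a v

theorem eval_apply (A : BFA α σ) (w : List α) (v : σ → Bool) :
    A.eval w v = A.g (w.foldr A.act v) := by
  have foldl_apply : ∀ h : (σ → Bool) → Bool,
      w.foldl A.stepFn h v = h (w.foldr A.act v) := by
    induction w with
    | nil => exact fun h => rfl
    | cons a w ih => exact fun h => ih (A.stepFn h a)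
  exact foldl_apply A.g

theorem mem_language (A : BFA α σ) (w : List α) :
    w ∈ A.language ↔ A.g (w.foldr A.act A.accept) = true := by
  rw [← eval_apply]
  rfl

/-- The NFA that guesses the state vectors of a BFA, with a new initial state `none`. -/
def toNFA (A : BFA α σ) : NFA α (Option (σ → Bool)) where
  step p a := { q | ∃ u, q = some u ∧
    p.elim (A.g (A.act a u) = true) (fun v => A.act a u = v) }
  start := {none}
  accept := { p | p.elim (A.g A.accept = true) (fun v => A.accept = v) }

end BFA

namespace NFA

variable {α σ : Type}

theorem mem_acceptsFrom_iff_exists (M : NFA α σ) (S : Set σ) (w : List α) :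
    w ∈ M.acceptsFrom S ↔ ∃ p ∈ S, w ∈ M.acceptsFrom {p} := by
  simp only [mem_acceptsFrom, M.mem_evalFrom_iff_exists (S := S)]
  tauto

theorem mem_accepts_of_start_eq {M : NFA α σ} {q₀ : σ} (h : M.start = {q₀}) (w : List α) :
    w ∈ M.accepts ↔ w ∈ M.acceptsFrom {q₀} := by
  rw [accepts_eq_acceptsFrom_start, h]

theorem append_mem_acceptsFrom_singleton (M : NFA α σ) (p : σ) (x y : List α) :
    x ++ y ∈ M.acceptsFrom {p} ↔ ∃ q ∈ M.evalFrom {p} x, y ∈ M.acceptsFrom {q} := by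
  rw [append_mem_acceptsFrom, mem_acceptsFrom_iff_exists]

end NFA

theorem BFA.mem_toNFA_acceptsFrom {α σ : Type} (A : BFA α σ) (p : Option (σ → Bool))
    (w : List α) :
    w ∈ A.toNFA.acceptsFrom {p} ↔
      p.elim (A.g (w.foldr A.act A.accept) = true) (fun v => w.foldr A.act A.accept = v) := by
  induction w generalizing p with
  | nil => simp [toNFA]
  | cons a w ih =>
    rw [NFA.cons_mem_acceptsFrom, NFA.stepSet_singleton, NFA.mem_acceptsFrom_iff_exists]
    simp only [ih]
    constructor
    · rintro ⟨_, ⟨u, rfl, hu⟩, hw⟩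
      simp only [Option.elim_some] at hw
      subst hw
      exact hu
    · exact fun h => ⟨some _, ⟨_, rfl, h⟩, rfl⟩

theorem BFA.toNFA_accepts {α σ : Type} (A : BFA α σ) : A.toNFA.accepts = A.language := by
  ext w
  rw [NFA.mem_accepts_of_start_eq (q₀ := none) rfl, mem_toNFA_acceptsFrom, mem_language]
  rfl

/-- Fooling-set lower bound for the reversal of a DFA with transition functions `f`,
initial state `s` and final states given by `g`. -/
theorem card_add_one_le_of_isolated {α E : Type} [Fintype E] (f : α → E → E) (s : E)
    (g : E → Prop) (reach : ∀ q, ∃ y : List α, y.foldr f s = q)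
    (isolate : ∀ q, ∃ x : List α, ∀ p, g (x.foldr f p) ↔ p = q)
    (two : ∃ p q, p ≠ q ∧ g p ∧ g q) {L : Language α}
    (hL : ∀ w, w ∈ L ↔ g (w.foldr f s)) {m : ℕ} (hm : AcceptsNFA1 L m) :
    Fintype.card E + 1 ≤ m := by
  obtain ⟨τ, _, rfl, M, q₀, hs, rfl⟩ := hm
  choose y hy using reach
  choose x hx using isolate
  have mem_iff : ∀ q r, x q ++ y r ∈ M.acceptsFrom {q₀} ↔ r = q := by
    intro q r
    rw [← NFA.mem_accepts_of_start_eq hs, hL, List.foldr_append, hy, hx]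
  have start_iff : ∀ q, y q ∈ M.acceptsFrom {q₀} ↔ g q := by
    intro q
    rw [← NFA.mem_accepts_of_start_eq hs, hL, hy]
  have crossing : ∀ q, ∃ t ∈ M.evalFrom {q₀} (x q), y q ∈ M.acceptsFrom {t} := fun q =>
    (M.append_mem_acceptsFrom_singleton _ _ _).1 ((mem_iff q q).2 rfl)
  choose t ht hty using crossing
  have eq_of_accepts : ∀ q r, y r ∈ M.acceptsFrom {t q} → r = q := fun q r h =>
    (mem_iff q r).1 ((M.append_mem_acceptsFrom_singleton _ _ _).2 ⟨t q, ht q, h⟩)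
  have t_ne : ∀ q, t q ≠ q₀ := by
    rintro q h
    obtain ⟨p, r, hne, hp, hr⟩ := two
    refine hne ((eq_of_accepts q p ?_).trans (eq_of_accepts q r ?_).symm)
    · rwa [h, start_iff]
    · rwa [h, start_iff]
  have inj : Function.Injective (fun o : Option E => o.elim q₀ t) := by
    rintro (_ | q) (_ | r) h
    · rfl
    · exact absurd h.symm (t_ne r)
    · exact absurd h (t_ne q)
    · have h' : t q = t r := h
      exact congrArg some (eq_of_accepts r q (h' ▸ hty q))
  simpa using Fintype.card_le_of_injective _ inj

/-- The letter `0` acts as `c`, the letter `1` sends `u` to `c u` and fixes all other points. -/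
def cycleMergeAct {E : Type} [DecidableEq E] (c : Equiv.Perm E) (u : E) (a : Fin 2) (p : E) : E :=
  if a = 0 then c p else if p = u then c u else p

section CycleMerge

variable {E : Type} [DecidableEq E] (c : Equiv.Perm E) (u : E)

theorem foldr_replicate_cycleMergeAct (k : ℕ) (p : E) :
    (List.replicate k 0).foldr (cycleMergeAct c u) p = (c ^ k) p := by
  induction k with
  | zero => rfl
  | succ k ih =>
    rw [List.replicate_succ, List.foldr_cons, ih, pow_succ']
    simp [cycleMergeAct]

theorem exists_isolate_cycleMergeAct [Fintype E] (hc : ∀ p q, ∃ k : ℕ, (c ^ k) p = q)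
    (g : E → Prop) (hg : ∃ p, g p) (hg' : ∃ p, ¬ g p) (q : E) :
    ∃ x : List (Fin 2), ∀ p, g (x.foldr (cycleMergeAct c u) p) ↔ p = q := by
  have shrink : ∀ (N : ℕ) (T : Finset E), T.card = N → T.Nonempty → (∃ p, p ∉ T) →
      (∃ x : List (Fin 2), ∀ p, g (x.foldr (cycleMergeAct c u) p) ↔ p ∈ T) →
      ∃ r, ∃ x : List (Fin 2), ∀ p, g (x.foldr (cycleMergeAct c u) p) ↔ p = r := by
    intro N
    induction N with
    | zero =>
      intro T hT hne
      exact absurd (Finset.card_eq_zero.1 hT) hne.ne_empty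
    | succ N ih =>
      rintro T hT ⟨t, ht⟩ ⟨t', ht'⟩ ⟨x, hx⟩
      rcases Nat.eq_zero_or_pos N with rfl | hN
      · obtain ⟨r, rfl⟩ := Finset.card_eq_one.1 hT
        exact ⟨r, x, by simpa using hx⟩
      have boundary : ∃ z ∈ T, c z ∉ T := by
        by_contra! h
        obtain ⟨k, rfl⟩ := hc t t'
        refine ht' ?_
        clear ht'
        induction k with
        | zero => exact ht
        | succ k ihk =>
          rw [pow_succ', Equiv.Perm.mul_apply]
          exact h _ ihk
      obtain ⟨z, hz, hcz⟩ := boundary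
      obtain ⟨k, hk⟩ := hc u z
      have hcu : (c ^ k) (c u) = c z := by
        rw [← hk, ← Equiv.Perm.mul_apply, ← Equiv.Perm.mul_apply, ← pow_succ, ← pow_succ']
      have hcard : ((T.map (c ^ k)⁻¹.toEmbedding).erase u).card = N := by
        rw [Finset.card_erase_of_mem, Finset.card_map, hT]
        · rfl
        · exact Finset.mem_map.2 ⟨z, hz, by simp [← hk]⟩
      have mem_shift : ∀ p, p ∈ T.map (c ^ k)⁻¹.toEmbedding ↔ (c ^ k) p ∈ T := by
        intro p
        simp only [Finset.mem_map, Equiv.coe_toEmbedding, Equiv.Perm.inv_eq_iff_eq]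
        simp
      refine ih _ hcard (Finset.card_pos.1 (hcard ▸ hN)) ⟨u, Finset.notMem_erase _ _⟩
        ⟨x ++ (List.replicate k 0 ++ [1]), fun p => ?_⟩
      rw [List.foldr_append, hx, List.foldr_append, foldr_replicate_cycleMergeAct,
        Finset.mem_erase, mem_shift]
      by_cases hp : p = u
      · simp [cycleMergeAct, hp, hcu, hcz]
      · simp [cycleMergeAct, hp]
  classical
  obtain ⟨r, x, hx⟩ := shrink _ (Finset.univ.filter g) rfl
    (by simpa [Finset.Nonempty] using hg) (by simpa using hg') ⟨[], by simp⟩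
  obtain ⟨k, rfl⟩ := hc q r
  refine ⟨x ++ List.replicate k 0, fun p => ?_⟩
  rw [List.foldr_append, hx, foldr_replicate_cycleMergeAct, EmbeddingLike.apply_eq_iff_eq]

end CycleMerge

theorem exists_perm_transitive (E : Type) [Finite E] :
    ∃ c : Equiv.Perm E, ∀ p q, ∃ k : ℕ, (c ^ k) p = q := by
  classical
  cases nonempty_fintype E
  obtain ⟨c, hc, -⟩ := (Finset.univ : Finset E).exists_cycleOn
  refine ⟨c, fun p q => ?_⟩
  obtain ⟨k, -, hk⟩ := hc.exists_pow_eq (Finset.mem_univ p) (Finset.mem_univ q)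
  exact ⟨k, hk⟩

theorem exists_afa_nfa_lower_bound (n : ℕ) (hn : 2 ≤ n) :
    ∃ L : Language (Fin 2), AcceptsAFA L n ∧ ∀ m : ℕ, AcceptsNFA1 L m → 2 ^ n + 1 ≤ m := by
  obtain ⟨c, hc⟩ := exists_perm_transitive (Fin n → Bool)
  let i₀ : Fin n := ⟨0, by lia⟩
  let i₁ : Fin n := ⟨1, by lia⟩
  let u : Fin n → Bool := fun _ => true
  let A : BFA (Fin 2) (Fin n) := ⟨fun q a v => cycleMergeAct c u a v q, fun v => v i₀, u⟩
  refine ⟨A.language, ⟨Fin n, inferInstance, Fintype.card_fin n, A, ⟨i₀, rfl⟩, rfl⟩,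
    fun m hm => ?_⟩
  have bound := card_add_one_le_of_isolated (cycleMergeAct c u) u (fun v => v i₀ = true)
    (fun q => ?_)
    (exists_isolate_cycleMergeAct c u hc (fun v => v i₀ = true) ⟨u, rfl⟩ ⟨fun _ => false, by simp⟩)
    ⟨u, fun i => decide (i = i₀), fun h => ?_, rfl, by simp⟩ A.mem_language hm
  · simpa using bound
  · obtain ⟨k, hk⟩ := hc u q
    exact ⟨List.replicate k 0, by rw [foldr_replicate_cycleMergeAct, hk]⟩
  · simpa [u, i₀, i₁] using congrFun h i₁

/-- Every language accepted by an `n`-state BFA is accepted by an NFA with a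
unique initial state having at most `2^n + 1` states; moreover for every
`n ≥ 2` there is a binary language accepted by an `n`-state AFA such that every
NFA with a unique initial state for it has at least `2^n + 1` states. -/
theorem bfa_to_nfa_tight :
    (∀ (α : Type) [Fintype α] (L : Language α) (n : ℕ), AcceptsBFA L n →
      ∃ m ≤ 2 ^ n + 1, AcceptsNFA1 L m) ∧
    ∀ n : ℕ, 2 ≤ n → ∃ L : Language (Fin 2), AcceptsAFA L n ∧
      ∀ m : ℕ, AcceptsNFA1 L m → 2 ^ n + 1 ≤ m := by
  refine ⟨?_, exists_afa_nfa_lower_bound⟩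
  rintro α _ _ n ⟨σ, _, rfl, A, rfl⟩
  classical
  exact ⟨_, le_rfl, Option (σ → Bool), inferInstance, by simp, A.toNFA, none, rfl,
    A.toNFA_accepts⟩
end

section
/- For all m, n ≥ 2 there exist languages K and L over a two-letter alphabet such that K is accepted by an m-state Boolean finite automaton, L is accepted by an n-state Boolean finite automaton, and every Boolean finite automaton accepting the concatenation KL has at least 2^m + n states. -/
namespace BFA

variable {α σ : Type}

/-- The valuation of the states obtained by reading `w` from right to left. -/
def valuation (A : BFA α σ) (w : List α) : σ → Bool :=
  w.foldr (fun a v q => A.δ q a v) A.accept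

theorem foldl_stepFn_apply (A : BFA α σ) (h : (σ → Bool) → Bool) (w : List α) (v : σ → Bool) :
    w.foldl A.stepFn h v = h (w.foldr (fun a v q => A.δ q a v) v) := by
  induction w generalizing h with
  | nil => rfl
  | cons a w ih => rw [List.foldl_cons, ih]; rfl

theorem mem_language_iff (A : BFA α σ) (w : List α) :
    w ∈ A.language ↔ A.g (A.valuation w) = true := by
  change A.eval w A.accept = true ↔ _
  rw [eval, foldl_stepFn_apply, valuation]

theorem append_mem_language_congr (A : BFA α σ) {u v : List α}
    (h : A.valuation u = A.valuation v) (x : List α) :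
    x ++ u ∈ A.language ↔ x ++ v ∈ A.language := by
  simp only [valuation] at h
  simp only [mem_language_iff, valuation, List.foldr_append, h]

end BFA

/-- Words that are pairwise separated by left contexts bound the number of states of a BFA. -/
theorem AcceptsBFA.card_le_two_pow {α ι : Type} [Fintype ι] {M : Language α} {k : ℕ}
    (h : AcceptsBFA M k) (w : ι → List α)
    (hw : ∀ i j, (∀ x, x ++ w i ∈ M ↔ x ++ w j ∈ M) → i = j) :
    Fintype.card ι ≤ 2 ^ k := by
  classical
  obtain ⟨σ, _, rfl, A, rfl⟩ := h
  have hinj : Function.Injective fun i => A.valuation (w i) :=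
    fun i j hij => hw i j (A.append_mem_language_congr hij)
  simpa using Fintype.card_le_of_injective _ hinj

/-- The words in which the number of occurrences of `a` is `r` modulo `p`. -/
def countLanguage {α : Type} [DecidableEq α] (a : α) (p : ℕ) (r : ZMod p) : Language α :=
  { w | (w.count a : ZMod p) = r }

theorem acceptsBFA_countLanguage {α : Type} [DecidableEq α] (a : α) (n : ℕ) (r : ZMod (2 ^ n)) :
    AcceptsBFA (countLanguage a (2 ^ n) r) n := by
  have e : (Fin n → Bool) ≃ ZMod (2 ^ n) := Fintype.equivOfCardEq (by simp [ZMod.card])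
  let A : BFA α (Fin n) :=
    { δ := fun q c v => e.symm (e v + if c = a then 1 else 0) q
      g := fun v => decide (e v = r)
      accept := e.symm 0 }
  have hval (w : List α) : e (A.valuation w) = w.count a := by
    induction w with
    | nil => exact (e.apply_symm_apply 0).trans Nat.cast_zero.symm
    | cons c w ih =>
      have : e (A.valuation (c :: w)) = e (A.valuation w) + if c = a then 1 else 0 :=
        e.apply_symm_apply _
      rw [this, ih, List.count_cons]
      split_ifs <;> simp_all
  refine ⟨Fin n, inferInstance, by simp, A, ?_⟩
  ext w
  rw [A.mem_language_iff]
  change decide (e (A.valuation w) = r) = true ↔ (w.count a : ZMod (2 ^ n)) = r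
  rw [decide_eq_true_iff, hval]

namespace CountConcat

variable {p q : ℕ}

/-- Transition, reading from right to left, of the subset automaton for the concatenation of
`{w | #₁ w ≡ 0 mod q}` and `{w | #₀ w ≡ -1 mod p}`. -/
def step (c : Fin 2) (s : ZMod p × Finset (ZMod q)) : ZMod p × Finset (ZMod q) :=
  if c = 0 then (s.1 + 1, if s.1 + 1 = -1 then insert 0 s.2 else s.2)
  else (s.1, if s.1 = -1 then insert 0 (s.2.image (· + 1)) else s.2.image (· + 1))

/-- The state of the subset automaton after reading `w` from right to left. -/
def state (p q : ℕ) (w : List (Fin 2)) : ZMod p × Finset (ZMod q) :=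
  w.foldr step (0, ∅)

theorem state_append (x w : List (Fin 2)) :
    state p q (x ++ w) = x.foldr step (state p q w) := by
  simp [state]

theorem state_fst (w : List (Fin 2)) : (state p q w).1 = w.count 0 := by
  induction w with
  | nil => simp [state]
  | cons c w ih =>
    change (step c (state p q w)).1 = _
    fin_cases c <;> simp [step, ih]

theorem mem_state_snd (hp : 1 < p) (w : List (Fin 2)) (s : ZMod q) :
    s ∈ (state p q w).2 ↔
      ∃ u v, w = u ++ v ∧ (v.count 0 : ZMod p) = -1 ∧ (u.count 1 : ZMod q) = s := by
  have : Fact (1 < p) := ⟨hp⟩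
  induction w generalizing s with
  | nil => simp [state, eq_comm (a := (0 : ZMod p))]
  | cons c w ih =>
    have hsplit : (∃ u v, c :: w = u ++ v ∧ (v.count 0 : ZMod p) = -1 ∧
          (u.count 1 : ZMod q) = s) ↔
        (((c :: w).count 0 : ZMod p) = -1 ∧ 0 = s) ∨
          ∃ u v, w = u ++ v ∧ (v.count 0 : ZMod p) = -1 ∧
            ((c :: u).count 1 : ZMod q) = s := by
      constructor
      · rintro ⟨u, v, h, hv, hu⟩
        cases u with
        | nil => left; simp_all
        | cons d u =>
          simp only [List.cons_append, List.cons.injEq] at h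
          obtain ⟨rfl, h⟩ := h
          exact .inr ⟨u, v, h, hv, hu⟩
      · rintro (⟨h, h'⟩ | ⟨u, v, rfl, hv, hu⟩)
        · exact ⟨[], c :: w, rfl, h, by simpa using h'⟩
        · exact ⟨c :: u, v, rfl, hv, hu⟩
    rw [hsplit]
    change s ∈ (step c (state p q w)).2 ↔ _
    fin_cases c
    · simp only [step, state_fst]
      simp only [Fin.zero_eta, if_true, List.count_cons_self, Nat.cast_add, Nat.cast_one]
      have := ih s
      split_ifs with h <;> simp_all [eq_comm]
    · have himg : s ∈ (state p q w).2.image (· + 1) ↔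
          ∃ u v, w = u ++ v ∧ (v.count 0 : ZMod p) = -1 ∧
            ((1 :: u).count 1 : ZMod q) = s := by
        simp only [Finset.mem_image, ih, List.count_cons_self, Nat.cast_add, Nat.cast_one]
        constructor
        · rintro ⟨_, ⟨u, v, h, hv, rfl⟩, rfl⟩
          exact ⟨u, v, h, hv, rfl⟩
        · rintro ⟨u, v, h, hv, rfl⟩
          exact ⟨_, ⟨u, v, h, hv, rfl⟩, rfl⟩
      simp only [step, state_fst]
      simp only [Fin.mk_one, one_ne_zero, if_false]
      rw [← himg]
      split_ifs with h <;> simp_all [eq_comm]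

theorem mem_mul_iff (hp : 1 < p) (w : List (Fin 2)) :
    w ∈ countLanguage 1 q 0 * countLanguage 0 p (-1) ↔ 0 ∈ (state p q w).2 := by
  rw [mem_state_snd hp, Language.mem_mul]
  constructor
  · rintro ⟨u, hu, v, hv, rfl⟩
    exact ⟨u, v, rfl, hv, hu⟩
  · rintro ⟨u, v, rfl, hv, hu⟩
    exact ⟨u, hu, v, hv, rfl⟩

theorem foldr_step_replicate_one {i : ZMod p} (hi : i ≠ -1) (S : Finset (ZMod q)) (t : ℕ) :
    (List.replicate t 1).foldr step (i, S) = (i, S.image (· + (t : ZMod q))) := by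
  induction t with
  | zero => simp
  | succ t ih =>
    rw [List.replicate_succ, List.foldr_cons, ih]
    simp [-Finset.image_add_right, step, hi, Finset.image_image, Function.comp_def, add_assoc]

theorem natCast_eq_neg_one_iff (k : ℕ) : (k : ZMod p) = -1 ↔ p ∣ k + 1 := by
  rw [← ZMod.natCast_eq_zero_iff, Nat.cast_add, Nat.cast_one, eq_neg_iff_add_eq_zero]

theorem natCast_ne_neg_one {k : ℕ} (hk : k + 1 < p) : (k : ZMod p) ≠ -1 := by
  rw [Ne, natCast_eq_neg_one_iff]
  exact Nat.not_dvd_of_pos_of_lt k.succ_pos hk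

theorem foldr_step_replicate_zero {i r : ℕ} (h : i + r + 1 < p) (S : Finset (ZMod q)) :
    (List.replicate r 0).foldr step ((i : ZMod p), S) = (((i + r : ℕ) : ZMod p), S) := by
  induction r with
  | zero => simp
  | succ r ih =>
    have hne := natCast_ne_neg_one h
    rw [List.replicate_succ, List.foldr_cons, ih (by omega)]
    push_cast at hne ⊢
    simp [step, add_assoc, hne]

theorem foldr_step_replicate_zero_wrap {i r : ℕ} (hr : 0 < r) (h : i + r + 1 = p)
    (S : Finset (ZMod q)) :
    (List.replicate r 0).foldr step ((i : ZMod p), S) = (-1, insert 0 S) := by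
  obtain ⟨r, rfl⟩ : ∃ k, r = k + 1 := ⟨r - 1, by omega⟩
  have heq : (((i + r + 1 : ℕ)) : ZMod p) = -1 :=
    (natCast_eq_neg_one_iff _).2 (by rw [← h]; exact dvd_of_eq (by ring))
  rw [List.replicate_succ, List.foldr_cons, foldr_step_replicate_zero (by omega)]
  push_cast at heq ⊢
  simp [step, heq]

theorem exists_state_eq_zero [NeZero q] (hp : 2 < p) (S : Finset (ZMod q)) :
    ∃ w, state p q w = (0, S) := by
  have h0 : (0 : ZMod p) ≠ -1 := by
    simpa using natCast_ne_neg_one (p := p) (k := 0) (by omega)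
  induction S using Finset.induction_on with
  | empty => exact ⟨[], rfl⟩
  | insert s S _ ih =>
    obtain ⟨w, hw⟩ := ih
    refine ⟨List.replicate s.val 1 ++ (0 :: (List.replicate (p - 1) 0 ++
      (List.replicate (-s).val 1 ++ w))), ?_⟩
    have hwrap := foldr_step_replicate_zero_wrap (p := p) (i := 0) (r := p - 1) (by omega)
      (by omega) (S.image (· + -s))
    rw [Nat.cast_zero] at hwrap
    have hstep (T : Finset (ZMod q)) : step 0 ((-1 : ZMod p), T) = (0, T) := by
      simp [step, h0]
    rw [state_append, ← List.singleton_append, state_append, state_append, state_append, hw,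
      foldr_step_replicate_one h0, ZMod.natCast_zmod_val, hwrap, List.foldr_cons, List.foldr_nil,
      hstep, foldr_step_replicate_one h0, ZMod.natCast_zmod_val]
    simp [-Finset.image_add_right, Finset.image_insert, Finset.image_image, Function.comp_def]

theorem exists_state_eq [NeZero q] (hp : 2 < p) {i : ℕ} (hi : i + 1 < p) (S : Finset (ZMod q)) :
    ∃ w, state p q w = ((i : ZMod p), S) := by
  obtain ⟨w, hw⟩ := exists_state_eq_zero hp S
  refine ⟨List.replicate i 0 ++ w, ?_⟩
  have := foldr_step_replicate_zero (p := p) (i := 0) (r := i) (by omega) S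
  rw [state_append, hw]
  simpa using this

theorem zero_mem_foldr_replicate_one [NeZero q] {i : ZMod p} (hi : i ≠ -1)
    (S : Finset (ZMod q)) (s : ZMod q) :
    0 ∈ ((List.replicate (-s).val 1).foldr step (i, S)).2 ↔ s ∈ S := by
  rw [foldr_step_replicate_one hi]
  simp

/-- The states `(i, S)` and `(j, S)` with `j < i < p - 1` are separated when `S` is not full. -/
theorem exists_separating_of_lt [NeZero q] {i j : ℕ} (hi : i + 1 < p) (hij : j < i)
    {S : Finset (ZMod q)} (hS : S ≠ Finset.univ) :
    ∃ x : List (Fin 2), 0 ∈ (x.foldr step ((i : ZMod p), S)).2 ∧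
      0 ∉ (x.foldr step ((j : ZMod p), S)).2 := by
  obtain ⟨s, hs⟩ : ∃ s, s ∉ S := by
    by_contra! h
    exact hS (Finset.eq_univ_iff_forall.2 h)
  have hi' := natCast_ne_neg_one hi
  have hj' := natCast_ne_neg_one (p := p) (k := j) (by omega)
  refine ⟨List.replicate (p - 1 - i) 0 ++ List.replicate (-s).val 1, ?_, ?_⟩
  · rw [List.foldr_append, foldr_step_replicate_one hi',
      foldr_step_replicate_zero_wrap (by omega) (by omega)]
    exact Finset.mem_insert_self _ _
  · have := (zero_mem_foldr_replicate_one hj' S s).not.2 hs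
    rw [List.foldr_append]
    rw [foldr_step_replicate_one hj'] at this ⊢
    rwa [foldr_step_replicate_zero (by omega)]

theorem eq_of_forall_foldr [NeZero q] {i j : ℕ} (hi : i + 1 < p) (hj : j + 1 < p)
    {S T : Finset (ZMod q)} (hS : S ≠ Finset.univ)
    (h : ∀ x : List (Fin 2), 0 ∈ (x.foldr step ((i : ZMod p), S)).2 ↔
      0 ∈ (x.foldr step ((j : ZMod p), T)).2) : i = j ∧ S = T := by
  have hST : S = T := by
    ext s
    rw [← zero_mem_foldr_replicate_one (natCast_ne_neg_one hi), h,
      zero_mem_foldr_replicate_one (natCast_ne_neg_one hj)]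
  subst hST
  refine ⟨?_, rfl⟩
  rcases lt_trichotomy i j with hlt | heq | hlt
  · obtain ⟨x, hx, hx'⟩ := exists_separating_of_lt hj hlt hS
    exact absurd ((h x).2 hx) hx'
  · exact heq
  · obtain ⟨x, hx, hx'⟩ := exists_separating_of_lt hi hlt hS
    exact absurd ((h x).1 hx) hx'

theorem card_le_two_pow [NeZero q] (hp : 2 < p) {k : ℕ}
    (h : AcceptsBFA (countLanguage (1 : Fin 2) q 0 * countLanguage 0 p (-1)) k) :
    (p - 1) * (2 ^ q - 1) ≤ 2 ^ k := by
  have hi (i : Fin (p - 1)) : i.val + 1 < p := by omega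
  choose w hw using fun x : Fin (p - 1) × {S : Finset (ZMod q) // S ≠ Finset.univ} =>
    exists_state_eq hp (hi x.1) x.2.1
  have hcard := h.card_le_two_pow w fun x y hxy => by
    simp only [mem_mul_iff (show 1 < p by omega), state_append, hw] at hxy
    obtain ⟨h₁, h₂⟩ := eq_of_forall_foldr (hi x.1) (hi y.1) x.2.2 hxy
    exact Prod.ext (Fin.ext h₁) (Subtype.ext h₂)
  have hsub : Fintype.card {S : Finset (ZMod q) // S ≠ Finset.univ} = 2 ^ q - 1 := by
    rw [Fintype.card_subtype_compl, Fintype.card_finset, ZMod.card, Fintype.card_unique]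
  rwa [Fintype.card_prod, Fintype.card_fin, hsub] at hcard

end CountConcat

/-- Concatenation on BFAs, lower bound: for all `m, n ≥ 2` there are binary
languages `K`, `L` accepted by an `m`-state and an `n`-state BFA such that
every BFA for `K * L` has at least `2^m + n` states. -/
theorem bfa_concat_lower (m n : ℕ) (hm : 2 ≤ m) (hn : 2 ≤ n) :
    ∃ K L : Language (Fin 2), AcceptsBFA K m ∧ AcceptsBFA L n ∧
      ∀ k : ℕ, AcceptsBFA (K * L) k → 2 ^ m + n ≤ k := by
  refine ⟨_, _, acceptsBFA_countLanguage 1 m 0, acceptsBFA_countLanguage 0 n (-1), fun k hk => ?_⟩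
  have hp : 2 ^ 2 ≤ 2 ^ n := Nat.pow_le_pow_right (by norm_num) hn
  have hq : 2 ^ 2 ≤ 2 ^ m := Nat.pow_le_pow_right (by norm_num) hm
  have hQ : 2 ^ 2 ^ 2 ≤ 2 ^ 2 ^ m := Nat.pow_le_pow_right (by norm_num) hq
  have hcard := CountConcat.card_le_two_pow (by omega) hk
  by_contra! hlt
  have hpow : 2 * 2 ^ k ≤ 2 ^ 2 ^ m * 2 ^ n := by
    rw [← pow_succ', ← pow_add]
    exact Nat.pow_le_pow_right (by norm_num) hlt
  generalize 2 ^ 2 ^ m = Q at *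
  generalize 2 ^ n = P at *
  obtain ⟨P, rfl⟩ : ∃ P', P = P' + 4 := ⟨P - 4, by omega⟩
  obtain ⟨Q, rfl⟩ : ∃ Q', Q = Q' + 16 := ⟨Q - 16, by omega⟩
  rw [show P + 4 - 1 = P + 3 by omega, show Q + 16 - 1 = Q + 15 by omega] at hcard
  nlinarith [Nat.zero_le (P * Q)]
end

section
/- Let K and L be languages over a finite alphabet Σ accepted by an m-state alternating finite automaton and an n-state alternating finite automaton, respectively. Then the concatenation KL is accepted by an alternating finite automaton with at most 2^m + n + 1 states. Moreover, for all m, n ≥ 2 there exist languages K and L over a two-letter alphabet accepted by an m-state and an n-state alternating finite automaton, respectively, such that every alternating finite automaton accepting KL has at least 2^m + n + 1 states. -/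
namespace BFA

variable {α σ : Type}

theorem foldl_stepFn (A : BFA α σ) (w : List α) (h : (σ → Bool) → Bool) (v : σ → Bool) :
    w.foldl A.stepFn h v = h (w.foldr (fun a v q => A.δ q a v) v) := by
  induction w generalizing h with
  | nil => rfl
  | cons a w ih => simp [ih, stepFn]

/-- The deterministic automaton on valuations that reads the input of a BFA backwards. -/
def toReverseDFA (A : BFA α σ) : DFA α (σ → Bool) where
  step v a := fun q => A.δ q a v
  start := A.accept
  accept := {v | A.g v = true}

theorem accepts_toReverseDFA (A : BFA α σ) : A.toReverseDFA.accepts = A.language.reverse := by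
  ext w
  rw [DFA.mem_accepts, Language.mem_reverse]
  change A.g _ = true ↔ w.reverse.foldl A.stepFn A.g A.accept = true
  rw [foldl_stepFn, List.foldr_reverse]
  rfl

end BFA

namespace DFA

variable {α σ τ : Type}

/-- A DFA whose states are encoded as valuations so that acceptance is the value of one
coordinate yields an AFA for the reversed language. -/
theorem acceptsAFA_reverse (D : DFA α τ) [Fintype σ] (enc : τ → σ → Bool)
    (henc : Function.Injective enc) (q₀ : σ) (hq₀ : ∀ t, enc t q₀ = true ↔ t ∈ D.accept) :
    AcceptsAFA D.accepts.reverse (Fintype.card σ) := by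
  have : Nonempty τ := ⟨D.start⟩
  let A : BFA α σ :=
    { δ := fun q a v => enc (D.step (Function.invFun enc v) a) q
      g := fun v => v q₀
      accept := enc D.start }
  have hA (w : List α) : A.toReverseDFA.eval w = enc (D.eval w) := by
    induction w using List.reverseRecOn with
    | nil => rfl
    | append_singleton w a ih =>
      rw [eval_append_singleton, eval_append_singleton, ih]
      change enc (D.step (Function.invFun enc (enc (D.eval w))) a) = _
      rw [Function.leftInverse_invFun henc]
  refine ⟨σ, inferInstance, rfl, A, ⟨q₀, rfl⟩, ?_⟩
  rw [← A.language.reverse_reverse, ← A.accepts_toReverseDFA]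
  congr 1
  ext w
  rw [mem_accepts, mem_accepts, hA, ← hq₀]
  rfl

/-- A DFA with `2 ^ n` states, half of which are accepting, yields an `n`-state AFA for the
reversed language. -/
theorem acceptsAFA_reverse_of_card (D : DFA α τ) [Fintype τ] {n : ℕ} (hn : 0 < n)
    (hcard : Fintype.card τ = 2 ^ n) (hacc : D.accept.ncard = 2 ^ (n - 1)) :
    AcceptsAFA D.accepts.reverse n := by
  classical
  obtain ⟨k, rfl⟩ : ∃ k, n = k + 1 := ⟨n - 1, by omega⟩
  have h₁ : Fintype.card {t // t ∈ D.accept} = Fintype.card (Fin k → Bool) := by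
    rw [← Nat.card_eq_fintype_card]
    exact (Nat.card_coe_set_eq D.accept).trans (by simpa using hacc)
  have h₂ : Fintype.card {t // t ∉ D.accept} = Fintype.card (Fin k → Bool) := by
    rw [Fintype.card_subtype_compl, h₁, hcard, pow_succ]
    simp
    omega
  let e₁ := Fintype.equivOfCardEq h₁
  let e₂ := Fintype.equivOfCardEq h₂
  let enc : τ → Option (Fin k) → Bool := fun t o =>
    if h : t ∈ D.accept then o.elim true (e₁ ⟨t, h⟩) else o.elim false (e₂ ⟨t, h⟩)
  have henc_none (t : τ) : enc t none = true ↔ t ∈ D.accept := by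
    by_cases h : t ∈ D.accept <;> simp [enc, h]
  have henc : Function.Injective enc := by
    intro s t hst
    have hiff : s ∈ D.accept ↔ t ∈ D.accept := by rw [← henc_none, ← henc_none, hst]
    by_cases hs : s ∈ D.accept
    · have ht := hiff.1 hs
      have : e₁ ⟨s, hs⟩ = e₁ ⟨t, ht⟩ := by
        funext i
        simpa [enc, hs, ht] using congrFun hst (some i)
      simpa using e₁.injective this
    · have ht : t ∉ D.accept := fun h => hs (hiff.2 h)
      have : e₂ ⟨s, hs⟩ = e₂ ⟨t, ht⟩ := by
        funext i
        simpa [enc, hs, ht] using congrFun hst (some i)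
      simpa using e₂.injective this
  simpa using D.acceptsAFA_reverse enc henc none henc_none

/-- The subset construction for concatenation: the first component runs `B`, the second one is
the set of states reached by the runs of `A` started whenever `B` accepts. -/
def concat (B : DFA α σ) (A : DFA α τ) : DFA α (σ × Set τ) where
  step p c := (B.step p.1 c,
    {y | (∃ x ∈ p.2, A.step x c = y) ∨ B.step p.1 c ∈ B.accept ∧ y = A.start})
  start := (B.start, {y | B.start ∈ B.accept ∧ y = A.start})
  accept := {p | ∃ x ∈ p.2, x ∈ A.accept}

theorem eval_concat (B : DFA α σ) (A : DFA α τ) (w : List α) :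
    (B.concat A).eval w =
      (B.eval w, {y | ∃ u v, u ++ v = w ∧ u ∈ B.accepts ∧ A.eval v = y}) := by
  induction w using List.reverseRecOn with
  | nil =>
    refine Prod.ext rfl (Set.ext fun y => ?_)
    simp [concat, mem_accepts, eq_comm]
  | append_singleton w c ih =>
    rw [eval_append_singleton, eval_append_singleton, ih]
    refine Prod.ext rfl (Set.ext fun y => ?_)
    constructor
    · rintro (⟨x, ⟨u, v, rfl, hu, rfl⟩, rfl⟩ | ⟨hB, rfl⟩)
      · exact ⟨u, v ++ [c], by simp, hu, by simp⟩
      · exact ⟨w ++ [c], [], by simp, by simpa [mem_accepts] using hB, by simp⟩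
    · rintro ⟨u, v, huv, hu, rfl⟩
      rcases List.eq_nil_or_concat v with rfl | ⟨v, d, rfl⟩
      · right
        rw [List.append_nil] at huv
        subst huv
        exact ⟨by simpa [mem_accepts] using hu, rfl⟩
      · left
        rw [List.concat_eq_append, ← List.append_assoc] at huv
        obtain ⟨rfl, hcd⟩ := List.append_inj' huv rfl
        obtain rfl : d = c := by simpa using hcd
        exact ⟨_, ⟨u, v, rfl, hu, rfl⟩, by simp⟩

theorem accepts_concat (B : DFA α σ) (A : DFA α τ) :
    (B.concat A).accepts = B.accepts * A.accepts := by
  ext w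
  rw [mem_accepts, eval_concat, Language.mem_mul]
  constructor
  · rintro ⟨_, ⟨u, v, rfl, hu, rfl⟩, hv⟩
    exact ⟨u, hu, v, hv, rfl⟩
  · rintro ⟨u, hu, v, hv, rfl⟩
    exact ⟨_, ⟨u, v, rfl, hu, rfl⟩, hv⟩

/-- A state reached from the start state by some word. -/
def Reachable (D : DFA α σ) (s : σ) : Prop := ∃ w, D.eval w = s

theorem Reachable.step {D : DFA α σ} {s : σ} (hs : D.Reachable s) (a : α) :
    D.Reachable (D.step s a) := by
  obtain ⟨w, rfl⟩ := hs
  exact ⟨w ++ [a], D.eval_append_singleton w a⟩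

/-- Two states accepting different languages. -/
def Separated (D : DFA α σ) (s t : σ) : Prop := ¬ D.acceptsFrom s = D.acceptsFrom t

theorem Separated.symm {D : DFA α σ} {s t : σ} (h : D.Separated s t) : D.Separated t s :=
  fun h' => h h'.symm

theorem Separated.of_evalFrom {D : DFA α σ} {s t : σ} (w : List α)
    (h : D.Separated (D.evalFrom s w) (D.evalFrom t w)) : D.Separated s t := by
  refine fun h' => h ?_
  ext x
  simpa [mem_acceptsFrom, evalFrom_of_append] using congrArg (w ++ x ∈ ·) h'

/-- If a DFA for the reversal of `L` has a set `W` of reachable, accepting, pairwise separated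
states, then `W` injects into the accepting valuations of every AFA for `L`. -/
theorem card_le_of_acceptsAFA {L : Language α} {D : DFA α σ} (hD : D.accepts = L.reverse)
    {W : Finset σ} (hreach : ∀ s ∈ W, D.Reachable s) (hacc : ∀ s ∈ W, s ∈ D.accept)
    (hsep : ∀ s ∈ W, ∀ t ∈ W, s ≠ t → D.Separated s t) {k : ℕ} (hk : AcceptsAFA L k) :
    0 < k ∧ W.card ≤ 2 ^ (k - 1) := by
  classical
  obtain ⟨ρ, _, rfl, A, ⟨q₀, hq₀⟩, rfl⟩ := hk
  refine ⟨Fintype.card_pos_iff.2 ⟨q₀⟩, ?_⟩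
  rw [← A.accepts_toReverseDFA] at hD
  choose! word hword using hreach
  let f : σ → {q // q ≠ q₀} → Bool := fun s q => A.toReverseDFA.eval (word s) q
  have hinj : Set.InjOn f W := by
    intro s hs t ht hst
    by_contra hne
    refine hsep s hs t ht hne ?_
    have htrue (s) (hs : s ∈ W) : A.toReverseDFA.eval (word s) q₀ = true := by
      have : word s ∈ A.toReverseDFA.accepts := by
        rw [← hD, mem_accepts, hword s hs]
        exact hacc s hs
      simpa [mem_accepts, BFA.toReverseDFA, hq₀] using this
    have heval : A.toReverseDFA.eval (word s) = A.toReverseDFA.eval (word t) := by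
      funext q
      by_cases hq : q = q₀
      · rw [hq, htrue s hs, htrue t ht]
      · exact congrFun hst ⟨q, hq⟩
    have key (s) (hs : s ∈ W) (x : List α) : x ∈ D.acceptsFrom s ↔
        x ∈ A.toReverseDFA.acceptsFrom (A.toReverseDFA.eval (word s)) := by
      have : word s ++ x ∈ D.accepts ↔ word s ++ x ∈ A.toReverseDFA.accepts := by rw [hD]
      simp only [mem_accepts, eval, evalFrom_of_append] at this
      rwa [show D.evalFrom D.start (word s) = s from hword s hs] at this
    ext x
    rw [key s hs, key t ht, heval]
  calc W.card ≤ (Finset.univ : Finset ({q // q ≠ q₀} → Bool)).card :=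
        Finset.card_le_card_of_injOn f (fun _ _ => Finset.mem_univ _) hinj
    _ = 2 ^ (Fintype.card ρ - 1) := by simp [Fintype.card_subtype_compl]

end DFA

theorem acceptsAFA_mul {α : Type} {K L : Language α} {m n : ℕ} (hK : AcceptsAFA K m)
    (hL : AcceptsAFA L n) : AcceptsAFA (K * L) (2 ^ m + n + 1) := by
  classical
  obtain ⟨σ, _, rfl, A, -, rfl⟩ := hK
  obtain ⟨τ, _, rfl, B, -, rfl⟩ := hL
  let D := B.toReverseDFA.concat A.toReverseDFA
  have hD : D.accepts.reverse = A.language * B.language := by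
    simp only [D]
    rw [DFA.accepts_concat, B.accepts_toReverseDFA, A.accepts_toReverseDFA,
      ← Language.reverse_mul, Language.reverse_reverse]
  let enc : (τ → Bool) × Set (σ → Bool) → Option ((σ → Bool) ⊕ τ) → Bool := fun p o =>
    o.elim (decide (p ∈ D.accept)) (Sum.elim (fun v => decide (v ∈ p.2)) p.1)
  have henc : Function.Injective enc := by
    intro p p' h
    refine Prod.ext (funext fun q => congrFun h (some (.inr q))) (Set.ext fun v => ?_)
    simpa [enc] using congrFun h (some (.inl v))
  have := D.acceptsAFA_reverse enc henc none (by simp [enc])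
  rw [hD] at this
  simpa using this

namespace ConcatWitness

open DFA

/-- First factor of the witness, with states `ZMod h × Bool`, accepting when the flag is set. -/
def left (h : ℕ) : DFA (Fin 2) (ZMod h × Bool) where
  step q c :=
    if c = 0 then (if q.2 then (q.1 + 1, false) else q)
    else if q.2 then (if q.1 = 1 then q else (q.1, false)) else (q.1, true)
  start := (0, false)
  accept := {q | q.2 = true}

/-- Second factor of the witness: the symbol `0` is a cyclic shift and `1` merges `0` into `1`. -/
def right (M H : ℕ) : DFA (Fin 2) (ZMod M) where
  step x c := if c = 0 then x + 1 else if x = 0 then 1 else x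
  start := 0
  accept := {x | ∃ j < H, x = -(j : ZMod M)}

/-- The subset automaton for the concatenation of the two factors. -/
abbrev auto (h M H : ℕ) : DFA (Fin 2) ((ZMod h × Bool) × Set (ZMod M)) :=
  (left h).concat (right M H)

/-- Cyclic shift of a set by one. -/
def shift {M : ℕ} (T : Set (ZMod M)) : Set (ZMod M) := {y | y - 1 ∈ T}

/-- Image of a set under the map merging `0` into `1`. -/
def push {M : ℕ} (T : Set (ZMod M)) : Set (ZMod M) :=
  {y | (y ≠ 0 ∧ y ∈ T) ∨ (y = 1 ∧ 0 ∈ T)}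

variable {h M H : ℕ}

theorem start_auto : (auto h M H).start = ((0, false), ∅) := by
  simp [concat, left]

theorem step_zero_false (i : ZMod h) (T : Set (ZMod M)) :
    (auto h M H).step ((i, false), T) 0 = ((i, false), shift T) := by
  refine Prod.ext (by simp [concat, left]) (Set.ext fun y => ?_)
  simp [concat, left, right, shift, ← eq_sub_iff_add_eq]

theorem step_zero_true (i : ZMod h) (T : Set (ZMod M)) :
    (auto h M H).step ((i, true), T) 0 = ((i + 1, false), shift T) := by
  refine Prod.ext (by simp [concat, left]) (Set.ext fun y => ?_)
  simp [concat, left, right, shift, ← eq_sub_iff_add_eq]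

theorem mem_push_iff (T : Set (ZMod M)) (y : ZMod M) :
    y ∈ push T ↔ ∃ x ∈ T, (if x = 0 then 1 else x) = y := by
  constructor
  · rintro (⟨hy, hT⟩ | ⟨rfl, hT⟩)
    · exact ⟨y, hT, by simp [hy]⟩
    · exact ⟨0, hT, by simp⟩
  · rintro ⟨x, hx, rfl⟩
    by_cases h0 : x = 0
    · subst h0
      right
      simpa using hx
    · left
      simpa [h0] using hx

theorem step_one_false (i : ZMod h) (T : Set (ZMod M)) :
    (auto h M H).step ((i, false), T) 1 = ((i, true), insert 0 (push T)) := by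
  refine Prod.ext (by simp [concat, left]) (Set.ext fun y => ?_)
  simp [concat, left, right, mem_push_iff, or_comm]

theorem step_one_true {i : ZMod h} (hi : i ≠ 1) (T : Set (ZMod M)) :
    (auto h M H).step ((i, true), T) 1 = ((i, false), push T) := by
  refine Prod.ext (by simp [concat, left, hi]) (Set.ext fun y => ?_)
  simp [concat, left, right, mem_push_iff, hi]

theorem step_one_true_one (T : Set (ZMod M)) :
    (auto h M H).step ((1, true), T) 1 = ((1, true), insert 0 (push T)) := by
  refine Prod.ext (by simp [concat, left]) (Set.ext fun y => ?_)
  simp [concat, left, right, mem_push_iff, or_comm]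

theorem push_insert_push (T : Set (ZMod M)) :
    push (insert 0 (push T)) = {y | y = 1 ∨ y ≠ 0 ∧ y ∈ T} := by
  ext y
  simp only [push, Set.mem_ofPred_eq, Set.mem_insert_iff]
  tauto

section Reachability

theorem rotate [NeZero M] {i : ZMod h} {T : Set (ZMod M)}
    (hT : (auto h M H).Reachable ((i, false), T)) (c : ZMod M) :
    (auto h M H).Reachable ((i, false), {y | y - c ∈ T}) := by
  rw [← ZMod.natCast_zmod_val c]
  induction c.val with
  | zero => simpa using hT
  | succ k ih =>
    have := ih.step 0
    rw [step_zero_false] at this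
    convert this using 2
    ext y
    simp [shift, sub_sub, add_comm]

theorem reachable_iff_rotate [NeZero M] {i : ZMod h} {T : Set (ZMod M)} (c : ZMod M) :
    (auto h M H).Reachable ((i, false), T) ↔
      (auto h M H).Reachable ((i, false), {y | y + c ∈ T}) :=
  ⟨fun hT => by simpa using rotate hT (-c), fun hT => by simpa using rotate hT c⟩

theorem reachable_add_one {i : ZMod h} {T : Set (ZMod M)}
    (hT : (auto h M H).Reachable ((i, false), T)) :
    (auto h M H).Reachable ((i + 1, false), shift (insert 0 (push T))) := by
  have := (hT.step 1).step 0
  rwa [step_one_false, step_zero_true] at this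

theorem exists_reachable_univ [NeZero M] :
    ∃ i : ZMod h, (auto h M H).Reachable ((i, false), Set.univ) := by
  have key (k : ℕ) : ∃ (i : ZMod h) (T : Set (ZMod M)),
      (auto h M H).Reachable ((i, false), T) ∧ ∀ j < k, ((j + 1 : ℕ) : ZMod M) ∈ T := by
    induction k with
    | zero => exact ⟨0, ∅, ⟨[], start_auto⟩, by simp⟩
    | succ k ih =>
      obtain ⟨i, T, hT, hk⟩ := ih
      refine ⟨_, _, reachable_add_one hT, fun j hj => ?_⟩
      simp only [shift, push, Set.mem_ofPred_eq, Set.mem_insert_iff]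
      rw [Nat.cast_add_one, add_sub_cancel_right]
      rcases j with _ | j
      · simp
      · have := hk j (by omega)
        tauto
  obtain ⟨i, T, hT, hM⟩ := key M
  refine ⟨i, ?_⟩
  convert hT
  refine (Set.eq_univ_of_forall fun x => ?_).symm
  have := hM (x - 1).val (ZMod.val_lt _)
  simpa using this

theorem reachable_univ [NeZero h] [NeZero M] (i : ZMod h) :
    (auto h M H).Reachable ((i, false), Set.univ) := by
  obtain ⟨j, hj⟩ := exists_reachable_univ (h := h) (M := M) (H := H)
  have key (k : ℕ) : (auto h M H).Reachable ((j + k, false), Set.univ) := by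
    induction k with
    | zero => simpa using hj
    | succ k ih =>
      have := reachable_add_one ih
      convert this using 2
      · simp [add_assoc]
      · ext y
        simp only [shift, push, Set.mem_univ, Set.mem_ofPred_eq, Set.mem_insert_iff]
        tauto
  have := key (i - j).val
  simpa using this

theorem exists_not_mem_add_one_mem [NeZero M] {T : Set (ZMod M)} (hT : T.Nonempty)
    (hT' : T ≠ Set.univ) : ∃ c, c ∉ T ∧ c + 1 ∈ T := by
  by_contra! hc
  refine hT' (Set.eq_univ_of_forall fun y => ?_)
  obtain ⟨x, hx⟩ := hT
  have key (k : ℕ) : x - k ∈ T := by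
    induction k with
    | zero => simpa using hx
    | succ k ih =>
      by_contra hk
      refine hc _ hk ?_
      convert ih using 1
      push_cast
      ring
  have := key (x - y).val
  simpa using this

theorem reachable_of_ne_one [NeZero h] [NeZero M] {i : ZMod h} (hi : i ≠ 1)
    {T : Set (ZMod M)} (hT : T.Nonempty) : (auto h M H).Reachable ((i, false), T) := by
  induction T using WellFoundedGT.induction with
  | ind T ih =>
  by_cases hT' : T = Set.univ
  · rw [hT']
    exact reachable_univ i
  obtain ⟨c, hc, hc1⟩ := exists_not_mem_add_one_mem hT hT'
  have hr := ih (insert c T) (Set.ssubset_insert hc) (Set.insert_nonempty _ _)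
  rw [reachable_iff_rotate c] at hr ⊢
  have := (hr.step 1).step 1
  rw [step_one_false, step_one_true hi, push_insert_push] at this
  convert this using 2
  ext y
  simp only [Set.mem_ofPred_eq, Set.mem_insert_iff, add_eq_right]
  constructor
  · intro hy
    exact Or.inr ⟨fun h0 => hc (by simpa [h0] using hy), Or.inr hy⟩
  · rintro (rfl | ⟨h0, h1⟩)
    · rwa [add_comm]
    · tauto

theorem reachable_true {i : ZMod h} {T : Set (ZMod M)} (h0 : 0 ∈ T)
    (hT : (auto h M H).Reachable ((i, false), T \ {0})) :
    (auto h M H).Reachable ((i, true), T) := by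
  have := hT.step 1
  rw [step_one_false] at this
  convert this using 2
  ext y
  by_cases hy : y = 0 <;> simp [push, hy, h0]

theorem reachable_false [Fact (1 < h)] [NeZero M] (i : ZMod h)
    {T : Set (ZMod M)} (hT : T.Nonempty) : (auto h M H).Reachable ((i, false), T) := by
  have : NeZero h := ⟨by have := Fact.out (p := 1 < h); omega⟩
  by_cases hi : i = 1
  · obtain ⟨x, hx⟩ := hT
    have h0 : (auto h M H).Reachable ((0, false), {y | y + x ∈ T} \ {0}) := by
      by_cases he : ({y | y + x ∈ T} \ {0}).Nonempty
      · exact reachable_of_ne_one zero_ne_one he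
      · rw [Set.not_nonempty_iff_eq_empty.1 he]
        exact ⟨[], start_auto⟩
    have := (reachable_true (by simpa using hx) h0).step 0
    rw [step_zero_true] at this
    rw [reachable_iff_rotate (x - 1), hi]
    convert this using 2
    · simp
    · ext y
      simp [shift, sub_add_eq_add_sub, add_sub_assoc]
  · exact reachable_of_ne_one hi hT

end Reachability

section Separation

/-- From every unflagged state with index different from `1`, the word `w` is accepted
exactly when the subset component meets `G`. -/
def Tests (h M H : ℕ) (w : List (Fin 2)) (G : Set (ZMod M)) : Prop :=
  ∀ i : ZMod h, i ≠ 1 → ∀ T : Set (ZMod M),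
    w ∈ (auto h M H).acceptsFrom ((i, false), T) ↔ ∃ x ∈ T, x ∈ G

theorem Tests.rotate [NeZero M] {w : List (Fin 2)} {G : Set (ZMod M)} (hw : Tests h M H w G)
    (c : ZMod M) : ∃ w', Tests h M H w' {y | y + c ∈ G} := by
  rw [← ZMod.natCast_zmod_val c]
  induction c.val with
  | zero => exact ⟨w, by simpa using hw⟩
  | succ k ih =>
    obtain ⟨w', hw'⟩ := ih
    refine ⟨0 :: w', fun i hi T => ?_⟩
    have := hw' i hi (shift T)
    rw [mem_acceptsFrom, evalFrom_cons, step_zero_false, ← mem_acceptsFrom, this]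
    constructor
    · rintro ⟨x, hx, hG⟩
      exact ⟨x - 1, hx, by simpa [add_comm, add_left_comm] using hG⟩
    · rintro ⟨x, hx, hG⟩
      exact ⟨x + 1, by simpa [shift] using hx, by
        simpa [add_comm, add_left_comm, add_assoc] using hG⟩

theorem Tests.diff_zero {w : List (Fin 2)} {G : Set (ZMod M)} (hw : Tests h M H w G)
    (h1 : 1 ∉ G) : Tests h M H (1 :: 1 :: w) (G \ {0}) := by
  intro i hi T
  rw [mem_acceptsFrom, evalFrom_cons, evalFrom_cons, step_one_false, step_one_true hi,
    push_insert_push, ← mem_acceptsFrom, hw i hi]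
  constructor
  · rintro ⟨x, rfl | ⟨h0, hx⟩, hG⟩
    · exact absurd hG h1
    · exact ⟨x, hx, hG, h0⟩
  · rintro ⟨x, hx, hG, h0⟩
    exact ⟨x, Or.inr ⟨h0, hx⟩, hG⟩

theorem exists_tests_singleton [NeZero M] (hH : 0 < H) (hHM : H < M) (x : ZMod M) :
    ∃ w, Tests h M H w {x} := by
  have key (l : ℕ) (hl : l < H) :
      ∃ w, Tests h M H w {y | ∃ j < H - l, y = -(j : ZMod M)} := by
    induction l with
    | zero => exact ⟨[], fun i _ T => Iff.rfl⟩
    | succ l ih =>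
      obtain ⟨w, hw⟩ := ih (by omega)
      have h1 : (1 : ZMod M) ∉ {y | ∃ j < H - l, y = -(j : ZMod M)} := by
        rintro ⟨j, hj, hj1⟩
        have : ((j + 1 : ℕ) : ZMod M) = 0 := by
          rw [Nat.cast_add_one, hj1]
          ring
        rw [ZMod.natCast_eq_zero_iff] at this
        have := Nat.le_of_dvd (by omega) this
        omega
      obtain ⟨w', hw'⟩ := (hw.diff_zero h1).rotate (-1)
      refine ⟨w', ?_⟩
      convert hw' using 1
      ext y
      constructor
      · rintro ⟨j, hj, rfl⟩
        refine ⟨⟨j + 1, by omega, by push_cast; ring⟩, fun h0 => ?_⟩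
        have : ((j + 1 : ℕ) : ZMod M) = 0 := by
          rw [Set.mem_singleton_iff] at h0
          rw [← neg_eq_zero, ← h0]
          push_cast
          ring
        rw [ZMod.natCast_eq_zero_iff] at this
        have := Nat.le_of_dvd (by omega) this
        omega
      · rintro ⟨⟨j, hj, hy⟩, h0⟩
        rcases j with _ | j
        · exact absurd (by simpa using hy) h0
        · refine ⟨j, by omega, ?_⟩
          rw [← sub_eq_add_neg, sub_eq_iff_eq_add] at hy
          rw [hy]
          push_cast
          ring
  obtain ⟨w, hw⟩ := key (H - 1) (by omega)
  obtain ⟨w', hw'⟩ := hw.rotate (-x)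
  refine ⟨w', ?_⟩
  convert hw' using 1
  ext y
  have : H - (H - 1) = 1 := by omega
  simp [this, add_neg_eq_zero]

theorem separated_of_ne_set [NeZero M] (hH : 0 < H) (hHM : H < M) {i j : ZMod h} (hi : i ≠ 1)
    (hj : j ≠ 1) {S T : Set (ZMod M)} (hST : S ≠ T) :
    (auto h M H).Separated ((i, false), S) ((j, false), T) := by
  refine fun heq => hST (Set.ext fun x => ?_)
  obtain ⟨w, hw⟩ := exists_tests_singleton (h := h) hH hHM x
  have h₁ := hw i hi S
  rw [heq, hw j hj T] at h₁
  simpa using h₁.symm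

theorem separated_false_one [Fact (1 < h)] [NeZero M] (hH : 0 < H) (hHM : H < M) {j : ZMod h}
    (hj : j ≠ 1) (S T : Set (ZMod M)) :
    (auto h M H).Separated ((1, false), S) ((j, false), T) := by
  have : Fact (1 < M) := ⟨by omega⟩
  refine .of_evalFrom [1, 1, 0] ?_
  simp only [evalFrom_cons, evalFrom_nil, step_one_false, step_one_true_one, step_one_true hj,
    step_zero_true, step_zero_false]
  refine separated_of_ne_set hH hHM (by simp) hj fun heq => ?_
  have : (1 : ZMod M) ∈ shift (push (insert 0 (push T))) := heq ▸ by simp [shift]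
  simp [shift, push] at this

theorem separated_false [Fact (1 < h)] [NeZero M] (hH : 0 < H) (hHM : H < M) {i j : ZMod h}
    (hij : i ≠ j) (S T : Set (ZMod M)) :
    (auto h M H).Separated ((i, false), S) ((j, false), T) := by
  have : NeZero h := ⟨by have := Fact.out (p := 1 < h); omega⟩
  obtain ⟨k, hk⟩ : ∃ k : ℕ, i + k = 1 := ⟨(1 - i).val, by simp⟩
  induction k generalizing i j S T with
  | zero =>
    obtain rfl : i = 1 := by simpa using hk
    exact separated_false_one hH hHM hij.symm S T
  | succ k ih =>
    refine .of_evalFrom [1, 0] ?_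
    simp only [evalFrom_cons, evalFrom_nil, step_one_false, step_zero_true]
    exact ih (by simpa using hij) _ _ (by rw [Nat.cast_succ] at hk; linear_combination hk)

theorem evalFrom_replicate_zero (k : ℕ) (i : ZMod h) (T : Set (ZMod M)) :
    (auto h M H).evalFrom ((i, false), T) (List.replicate k 0) =
      ((i, false), {y | y - (k : ZMod M) ∈ T}) := by
  induction k generalizing T with
  | zero => simp
  | succ k ih =>
    rw [List.replicate_succ, evalFrom_cons, step_zero_false, ih]
    congr 1
    ext y
    simp [shift, sub_sub]

theorem separated_false_of_ne_set [Fact (1 < h)] [NeZero M] (hH : 0 < H) (hHM : H < M)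
    (hM : 2 < M) (i : ZMod h) {S T : Set (ZMod M)} (hST : S ≠ T) :
    (auto h M H).Separated ((i, false), S) ((i, false), T) := by
  have : Fact (1 < M) := ⟨by omega⟩
  by_cases hi : i = 1
  · subst hi
    obtain ⟨x, hx⟩ : ∃ x, ¬(x ∈ S ↔ x ∈ T) := by
      by_contra! hx
      exact hST (Set.ext hx)
    have h20 : (2 : ZMod M) ≠ 0 := by
      intro h2
      have := (ZMod.natCast_eq_zero_iff 2 M).1 (by exact_mod_cast h2)
      have := Nat.le_of_dvd (by omega) this
      omega
    have h21 : (2 : ZMod M) ≠ 1 := by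
      intro h2
      exact one_ne_zero (α := ZMod M) (by linear_combination h2)
    refine .of_evalFrom (List.replicate (2 - x).val 0) ?_
    rw [evalFrom_replicate_zero, evalFrom_replicate_zero]
    refine .of_evalFrom [1, 0] ?_
    simp only [evalFrom_cons, evalFrom_nil, step_one_false,
      step_zero_true]
    refine separated_of_ne_set hH hHM (by simp) (by simp) fun heq => hx ?_
    have h3 : (3 : ZMod M) - 1 = 2 := by ring
    simpa [shift, push, h3, h20, h21] using congrArg (3 ∈ ·) heq
  · exact separated_of_ne_set hH hHM hi hi hST

theorem separated_true [Fact (1 < h)] [NeZero M] (hH : 0 < H) (hHM : H < M)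
    (hM : 2 < M) {i j : ZMod h} {S T : Set (ZMod M)} (hne : ((i, true), S) ≠ ((j, true), T)) :
    (auto h M H).Separated ((i, true), S) ((j, true), T) := by
  refine .of_evalFrom [0] ?_
  simp only [evalFrom_cons, evalFrom_nil, step_zero_true]
  by_cases hij : i = j
  · subst hij
    refine separated_false_of_ne_set hH hHM hM _ fun heq => hne ?_
    congr 1
    ext x
    simpa [shift] using congrArg (x + 1 ∈ ·) heq
  · exact separated_false hH hHM (by simpa using hij) _ _

theorem separated_true_false [Fact (1 < h)] [NeZero M] (hH : 0 < H) (hHM : H < M)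
    {i j : ZMod h} {S T : Set (ZMod M)} :
    (auto h M H).Separated ((i, true), S) ((j, false), T) := by
  have : Fact (1 < M) := ⟨by omega⟩
  by_cases hij : i + 1 = j
  · subst hij
    by_cases hi : i = 1
    · subst hi
      refine .of_evalFrom [1, 0] ?_
      simp only [evalFrom_cons, evalFrom_nil, step_one_false, step_one_true_one, step_zero_true]
      exact separated_false hH hHM (by simp) _ _
    · refine .of_evalFrom [1, 0] ?_
      simp only [evalFrom_cons, evalFrom_nil, step_one_false, step_one_true hi, step_zero_true,
        step_zero_false]
      by_cases hi2 : i = i + 1 + 1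
      · rw [← hi2]
        refine separated_of_ne_set hH hHM hi hi fun heq => ?_
        have : (1 : ZMod M) ∈ shift (push S) := heq ▸ by simp [shift]
        simp [shift, push] at this
      · exact separated_false hH hHM hi2 _ _
  · refine .of_evalFrom [0] ?_
    simp only [evalFrom_cons, evalFrom_nil, step_zero_true, step_zero_false]
    exact separated_false hH hHM hij _ _

end Separation

open scoped Classical in
/-- Accepting reachable states of the subset automaton. -/
noncomputable def states (h M H : ℕ) [NeZero h] [NeZero M] :
    Finset ((ZMod h × Bool) × Set (ZMod M)) :=
  Finset.univ.filter fun p => p ∈ (auto h M H).accept ∧ (p.1.2 = true → 0 ∈ p.2 ∧ p.2 ≠ {0})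

theorem mem_states [NeZero h] [NeZero M] {p : (ZMod h × Bool) × Set (ZMod M)} :
    p ∈ states h M H ↔
      p ∈ (auto h M H).accept ∧ (p.1.2 = true → 0 ∈ p.2 ∧ p.2 ≠ {0}) := by
  simp [states]

theorem reachable_of_mem_states [Fact (1 < h)] [NeZero h] [NeZero M]
    {p : (ZMod h × Bool) × Set (ZMod M)} (hp : p ∈ states h M H) : (auto h M H).Reachable p := by
  obtain ⟨⟨i, f⟩, T⟩ := p
  obtain ⟨⟨x, hx, -⟩, hf⟩ := mem_states.1 hp
  cases f with
  | false => exact reachable_false i ⟨x, hx⟩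
  | true =>
    obtain ⟨h0, hne⟩ := hf rfl
    refine reachable_true h0 (reachable_false i ?_)
    by_contra hemp
    rw [Set.not_nonempty_iff_eq_empty, Set.sdiff_eq_empty] at hemp
    exact hne (hemp.antisymm (by simpa using h0))

theorem separated_of_ne [Fact (1 < h)] [NeZero M] (hH : 0 < H) (hHM : H < M) (hM : 2 < M)
    {p q : (ZMod h × Bool) × Set (ZMod M)} (hpq : p ≠ q) : (auto h M H).Separated p q := by
  obtain ⟨⟨i, f⟩, S⟩ := p
  obtain ⟨⟨j, g⟩, T⟩ := q
  cases f <;> cases g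
  · by_cases hij : i = j
    · subst hij
      exact separated_false_of_ne_set hH hHM hM i fun hST => hpq (by rw [hST])
    · exact separated_false hH hHM hij S T
  · exact (separated_true_false hH hHM).symm
  · exact separated_true_false hH hHM
  · exact separated_true hH hHM hM hpq

theorem ncard_accept_right [NeZero M] (hHM : H ≤ M) : (right M H).accept.ncard = H := by
  have : (right M H).accept = (fun j : ℕ => -(j : ZMod M)) '' (Finset.range H) := by
    ext x
    simp [right, eq_comm]
  rw [this, Set.InjOn.ncard_image, Set.ncard_coe_finset, Finset.card_range]
  intro j hj k hk hjk
  rw [Finset.coe_range, Set.mem_Iio] at hj hk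
  have := (ZMod.natCast_eq_natCast_iff' j k M).1 (neg_injective hjk)
  rwa [Nat.mod_eq_of_lt (by omega), Nat.mod_eq_of_lt (by omega)] at this

theorem ncard_accept_left [NeZero h] : (left h).accept.ncard = h := by
  have : (left h).accept = (fun i : ZMod h => (i, true)) '' Set.univ := by
    ext ⟨i, f⟩
    cases f <;> simp [left]
  rw [this, Set.ncard_image_of_injective _ (Prod.mk_left_injective true), Set.ncard_univ,
    Nat.card_zmod]

open scoped Classical in
theorem card_filter_not_subset [NeZero M] (A : Set (ZMod M)) :
    2 ^ M ≤ (Finset.univ.filter fun T : Set (ZMod M) => ¬ T ⊆ A).card + 2 ^ A.ncard := by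
  have hA : (Finset.univ.filter fun T : Set (ZMod M) => T ⊆ A).card = 2 ^ A.ncard := by
    rw [← Set.ncard_powerset, ← Set.ncard_coe_finset]
    congr 1
    ext T
    simp
  have := Finset.card_filter_add_card_filter_not (s := Finset.univ)
    (fun T : Set (ZMod M) => T ⊆ A)
  rw [hA, Finset.card_univ, Fintype.card_set, ZMod.card] at this
  omega

theorem lt_card_states [NeZero h] (hH : 2 ≤ H) [NeZero (2 * H)] :
    h * 2 ^ (2 * H) < (states h (2 * H) H).card := by
  classical
  let P := Finset.univ.filter fun T : Set (ZMod (2 * H)) => ¬ T ⊆ (right (2 * H) H).acceptᶜ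
  let Q := Finset.univ.filter fun T : Set (ZMod (2 * H)) => 0 ∈ T ∧ T ≠ {0}
  have hP : 2 ^ (2 * H) ≤ P.card + 2 ^ H := by
    have := card_filter_not_subset (right (2 * H) H).acceptᶜ
    rwa [Set.ncard_compl, ncard_accept_right (by omega), Nat.card_zmod,
      show 2 * H - H = H by omega] at this
  have hQ : 2 ^ (2 * H) ≤ Q.card + 1 + 2 ^ (2 * H - 1) := by
    have := card_filter_not_subset ({0}ᶜ : Set (ZMod (2 * H)))
    rw [Set.ncard_compl, Set.ncard_singleton, Nat.card_zmod] at this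
    refine this.trans (Nat.add_le_add_right ?_ _)
    rw [← Finset.card_singleton ({0} : Set (ZMod (2 * H)))]
    refine (Finset.card_le_card fun T hT => ?_).trans (Finset.card_union_le _ _)
    by_cases hT0 : T = {0}
    · simp [hT0]
    · simpa [Q, hT0] using hT
  have hcard : (states h (2 * H) H).card = h * (P.card + Q.card) := by
    have hacc (T : Set (ZMod (2 * H))) (q : ZMod h × Bool) :
        (q, T) ∈ (auto h (2 * H) H).accept ↔ ¬ T ⊆ (right (2 * H) H).acceptᶜ := by
      simp [concat, Set.not_subset]
    have hzero (T : Set (ZMod (2 * H))) (hT : 0 ∈ T) : ¬ T ⊆ (right (2 * H) H).acceptᶜ :=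
      Set.not_subset.2 ⟨0, hT, fun h0 => h0 ⟨0, by omega, by simp⟩⟩
    have hq (T : Set (ZMod (2 * H))) : (¬ T ⊆ (right (2 * H) H).acceptᶜ ∧ 0 ∈ T ∧ T ≠ {0}) ↔
        0 ∈ T ∧ T ≠ {0} := and_iff_right_of_imp fun hT => hzero T hT.1
    rw [states, Finset.card_filter, Fintype.sum_prod_type, Fintype.sum_prod_type]
    simp only [hacc, Fintype.sum_bool, forall_const, hq, Bool.false_eq_true, IsEmpty.forall_iff,
      and_true, ← Finset.card_filter, Finset.sum_const, Finset.card_univ, ZMod.card, smul_eq_mul]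
    rw [add_comm P.card]
  have hpow : 2 ^ (2 * H - 1) = 2 ^ H * 2 ^ (H - 1) := by
    rw [← pow_add]
    congr 1
    omega
  have hpow' : 2 ^ (2 * H) = 2 * 2 ^ (2 * H - 1) := by
    rw [← pow_succ']
    congr 1
    omega
  have h₁ : 2 ≤ 2 ^ (H - 1) := Nat.le_self_pow (by omega) 2
  have h₂ : 4 ≤ 2 ^ H := Nat.pow_le_pow_right (n := 2) (by norm_num) hH
  rw [hcard]
  refine Nat.mul_lt_mul_of_pos_left ?_ (NeZero.pos h)
  nlinarith

end ConcatWitness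

/-- Concatenation on AFAs: the upper bound `2^m + n + 1` holds, and it is
tight over a binary alphabet for all `m, n ≥ 2`. -/
theorem afa_concat_tight :
    (∀ (α : Type) [Fintype α] (K L : Language α) (m n : ℕ),
      AcceptsAFA K m → AcceptsAFA L n →
        ∃ k ≤ 2 ^ m + n + 1, AcceptsAFA (K * L) k) ∧
    ∀ m n : ℕ, 2 ≤ m → 2 ≤ n → ∃ K L : Language (Fin 2),
      AcceptsAFA K m ∧ AcceptsAFA L n ∧
      ∀ k : ℕ, AcceptsAFA (K * L) k → 2 ^ m + n + 1 ≤ k := by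
  refine ⟨fun α _ K L m n hK hL => ⟨_, le_rfl, acceptsAFA_mul hK hL⟩, fun m n hm hn => ?_⟩
  obtain ⟨m, rfl⟩ : ∃ k, m = k + 1 := ⟨m - 1, by omega⟩
  obtain ⟨n, rfl⟩ : ∃ k, n = k + 1 := ⟨n - 1, by omega⟩
  have hM : (2 : ℕ) ^ (m + 1) = 2 * 2 ^ m := by ring
  have hH : 2 ≤ 2 ^ m := Nat.le_self_pow (by omega) 2
  have hn' : 1 < 2 ^ n := Nat.one_lt_two_pow (by omega)
  have : Fact (1 < 2 ^ n) := ⟨hn'⟩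
  refine ⟨(ConcatWitness.right (2 * 2 ^ m) (2 ^ m)).accepts.reverse,
    (ConcatWitness.left (2 ^ n)).accepts.reverse, ?_, ?_, fun k hk => ?_⟩
  · refine DFA.acceptsAFA_reverse_of_card _ (by omega) ?_ ?_
    · rw [ZMod.card, hM]
    · rw [ConcatWitness.ncard_accept_right (by omega), Nat.add_sub_cancel]
  · refine DFA.acceptsAFA_reverse_of_card _ (by omega) ?_ ?_
    · rw [Fintype.card_prod, ZMod.card, Fintype.card_bool, pow_succ]
    · rw [ConcatWitness.ncard_accept_left, Nat.add_sub_cancel]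
  · obtain ⟨hk0, hcard⟩ := DFA.card_le_of_acceptsAFA
      (D := ConcatWitness.auto (2 ^ n) (2 * 2 ^ m) (2 ^ m))
      (by rw [DFA.accepts_concat, Language.reverse_mul, Language.reverse_reverse,
        Language.reverse_reverse])
      (fun s hs => ConcatWitness.reachable_of_mem_states hs)
      (fun s hs => (ConcatWitness.mem_states.1 hs).1)
      (fun s _ t _ hst => ConcatWitness.separated_of_ne (by omega) (by omega) (by omega) hst) hk
    have hlt := (ConcatWitness.lt_card_states hH).trans_le hcard
    rw [← pow_add] at hlt
    have := (Nat.pow_lt_pow_iff_right (by norm_num)).1 hlt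
    omega
end
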